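/- arXiv:1808.07871 — 2 statements merged into one kernel-verified Lean document; each statement's English description precedes it below -/
import Mathlib

section
/- (Linear-algebraic core of the I_n-Theorem.) Fix an integer N ≥ 2 and a subset Î of {1,…,N} with |Î| ≥ 2. A real-valued vector Q indexed by the nonempty subsets of {1,…,N} satisfies every canonical constraint F_I for nonempty I ≠ Î if and only if there exists λ ∈ ℝ such that Q_K = λ·(−1)^{|K|+1} for every nonempty K ⊆ Î and Q_K = 0 for every nonempty K not contained in Î; that is, the solution space of the system {F_I : I ∈ P, I ≠ Î} is exactly the one-dimensional span of the multipartite-information coefficient vector Q^Î. -/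
/-- The coefficient `Q^J_K` of multipartite information: `(-1)^(|K|+1)` on subsets of `J`. -/
def multipartiteCoeff {α : Type*} [DecidableEq α] (J K : Finset α) : ℝ :=
  if K ⊆ J then (-1) ^ (K.card + 1) else 0

theorem sum_superset_multipartiteCoeff_self {α : Type*} [Fintype α] [DecidableEq α]
    (J : Finset α) :
    ∑ K ∈ Finset.univ.powerset.filter (fun K => J ⊆ K), multipartiteCoeff J K =
      (-1) ^ (J.card + 1) := by
  rw [Finset.sum_eq_single J]
  · simp [multipartiteCoeff]
  · intro K hK hne
    have hJK : J ⊆ K := (Finset.mem_filter.mp hK).2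
    exact if_neg fun h => hne (h.antisymm hJK)
  · simp

theorem sum_superset_multipartiteCoeff_of_ne {α : Type*} [Fintype α] [DecidableEq α]
    {I J : Finset α} (hIJ : I ≠ J) :
    ∑ K ∈ Finset.univ.powerset.filter (fun K => I ⊆ K), multipartiteCoeff J K = 0 := by
  by_cases hsub : I ⊆ J
  · obtain ⟨a, haJ, haI⟩ := Finset.exists_of_ssubset (hsub.ssubset_of_ne hIJ)
    refine Finset.sum_involution (fun K _ => if a ∈ K then K.erase a else insert a K)
      ?_ ?_ ?_ ?_
    · intro K _
      by_cases haK : a ∈ K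
      · have hiff : K.erase a ⊆ J ↔ K ⊆ J := by
          rw [← Finset.subset_insert_iff, Finset.insert_eq_of_mem haJ]
        have hcard := Finset.card_erase_add_one haK
        simp only [multipartiteCoeff, if_pos haK, hiff]
        split_ifs
        · rw [← hcard]; ring
        · simp
      · have hiff : insert a K ⊆ J ↔ K ⊆ J := by simp [Finset.insert_subset_iff, haJ]
        simp only [multipartiteCoeff, if_neg haK, hiff, Finset.card_insert_of_notMem haK]
        split_ifs
        · ring
        · simp
    · intro K _ _
      split_ifs with haK
      · exact fun h => Finset.notMem_erase a K (h.symm ▸ haK)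
      · exact fun h => haK (h ▸ Finset.mem_insert_self a K)
    · intro K hK
      have hIK : I ⊆ K := (Finset.mem_filter.mp hK).2
      simp only [Finset.mem_filter, Finset.powerset_univ, Finset.mem_univ, true_and]
      split_ifs
      · exact Finset.subset_erase.mpr ⟨hIK, haI⟩
      · exact hIK.trans (Finset.subset_insert a K)
    · intro K _
      by_cases haK : a ∈ K <;> simp [haK]
  · refine Finset.sum_eq_zero fun K hK => if_neg fun hKJ => hsub ?_
    exact (Finset.mem_filter.mp hK).2.trans hKJ

/-- The canonical constraints for all nonempty `I` have only the zero solution. -/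
theorem eq_zero_of_sum_superset_eq_zero {α : Type*} [Fintype α] [DecidableEq α]
    {R : Finset α → ℝ}
    (hR : ∀ I : Finset α, I.Nonempty →
      ∑ K ∈ Finset.univ.powerset.filter (fun K => I ⊆ K), R K = 0)
    (K : Finset α) (hK : K.Nonempty) : R K = 0 := by
  induction K using WellFoundedGT.induction with
  | ind K ih =>
    rw [← hR K hK, Finset.sum_eq_single K]
    · intro L hL hne
      have hKL : K ⊆ L := (Finset.mem_filter.mp hL).2
      exact ih L (hKL.ssubset_of_ne hne.symm) (hK.mono hKL)
    · simp

/-- Linear-algebraic core of the I_n-Theorem: Fix N ≥ 2 and a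
subset Î of {1,…,N} with |Î| ≥ 2. A real vector `Q` indexed by the nonempty
subsets of {1,…,N} satisfies every canonical constraint `F_I` with nonempty
`I ≠ Î` iff there is `λ ∈ ℝ` with `Q K = λ·(−1)^{|K|+1}` for nonempty `K ⊆ Î`
and `Q K = 0` for nonempty `K ⊄ Î`; i.e. the solution space is exactly the
one-dimensional span of the multipartite-information coefficient vector. -/
theorem In_theorem_linear_core (N : ℕ) (hN : 2 ≤ N)
    (Ihat : Finset (Fin N)) (hIhat : 2 ≤ Ihat.card)
    (Q : Finset (Fin N) → ℝ) :
    (∀ I : Finset (Fin N), I.Nonempty → I ≠ Ihat →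
        ∑ K ∈ Finset.univ.powerset.filter (fun K => I ⊆ K), Q K = 0) ↔
      (∃ l : ℝ,
        (∀ K : Finset (Fin N), K.Nonempty → K ⊆ Ihat →
            Q K = l * ((-1 : ℝ)) ^ (K.card + 1)) ∧
        (∀ K : Finset (Fin N), K.Nonempty → ¬ K ⊆ Ihat → Q K = 0)) := by
  constructor
  · intro h
    set c := ∑ K ∈ Finset.univ.powerset.filter (fun K => Ihat ⊆ K), Q K with hc
    have hsol : ∀ K : Finset (Fin N), K.Nonempty →
        Q K - c * (-1) ^ (Ihat.card + 1) * multipartiteCoeff Ihat K = 0 := by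
      refine eq_zero_of_sum_superset_eq_zero fun I hI => ?_
      rw [Finset.sum_sub_distrib, ← Finset.mul_sum]
      by_cases hne : I = Ihat
      · subst hne
        rw [sum_superset_multipartiteCoeff_self, ← hc, mul_assoc, ← mul_pow]
        simp
      · rw [h I hI hne, sum_superset_multipartiteCoeff_of_ne hne]
        simp
    refine ⟨c * (-1) ^ (Ihat.card + 1), fun K hK hsub => ?_, fun K hK hsub => ?_⟩
    · simpa [multipartiteCoeff, hsub, sub_eq_zero] using hsol K hK
    · simpa [multipartiteCoeff, hsub] using hsol K hK
  · rintro ⟨l, hin, hout⟩ I hI hne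
    rw [← mul_zero l, ← sum_superset_multipartiteCoeff_of_ne hne, Finset.mul_sum]
    refine Finset.sum_congr rfl fun K hK => ?_
    have hKne : K.Nonempty := hI.mono (Finset.mem_filter.mp hK).2
    by_cases hsub : K ⊆ Ihat
    · simp [multipartiteCoeff, hsub, hin K hKne hsub]
    · simp [multipartiteCoeff, hsub, hout K hKne hsub]
end

section
/- Fix an integer N ≥ 1. If a real-valued vector Q indexed by the nonempty subsets of {1,…,N} satisfies the canonical constraint F_I for every nonempty proper subset I ⊊ {1,…,N}, then Q_K = (−1)^{N−|K|} · Q_{{1,…,N}} for every nonempty subset K of {1,…,N}; i.e., upon removing only the top constraint F_{{1,…,N}}, the coefficients are forced to alternate in sign with the cardinality of the index set, reproducing (up to overall scale) the N-partite information. -/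
/-- The alternating sum of `(-1) ^ #Kᶜ` over all supersets `K` of a proper subset vanishes. -/
theorem sum_superset_neg_one_pow_card_compl {α : Type*} [Fintype α] [DecidableEq α]
    {I : Finset α} (hI : I ≠ Finset.univ) :
    ∑ K ∈ Finset.univ.powerset.filter (fun K => I ⊆ K),
      (-1 : ℝ) ^ (Fintype.card α - K.card) = 0 := by
  have h : ∑ J ∈ Iᶜ.powerset, (-1 : ℝ) ^ J.card = 0 := by
    have hne : Iᶜ.Nonempty := by
      rwa [Finset.nonempty_iff_ne_empty, Ne, Finset.compl_eq_empty_iff]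
    exact_mod_cast Finset.sum_powerset_neg_one_pow_card_of_nonempty hne
  rw [← h]
  refine Finset.sum_bij' (fun K _ => Kᶜ) (fun J _ => Jᶜ) ?_ ?_ ?_ ?_ ?_
  · intro K hK
    simpa using hK
  · intro J hJ
    simpa [Finset.subset_compl_comm] using hJ
  · simp
  · simp
  · intro K _
    rw [Finset.card_compl]

/-- Fix N ≥ 1. If a real vector `Q` indexed by nonempty subsets
of {1,…,N} satisfies the canonical constraint `F_I` for every nonempty proper
subset `I ⊊ {1,…,N}`, then `Q K = (−1)^{N−|K|} · Q_{{1,…,N}}` for every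
nonempty subset `K`: removing only the top constraint forces alternating
signs, reproducing (up to scale) the N-partite information. -/
theorem remove_top_constraint_gives_In (N : ℕ) (hN : 1 ≤ N)
    (Q : Finset (Fin N) → ℝ)
    (hQ : ∀ I : Finset (Fin N), I.Nonempty → I ≠ Finset.univ →
      ∑ K ∈ Finset.univ.powerset.filter (fun K => I ⊆ K), Q K = 0) :
    ∀ K : Finset (Fin N), K.Nonempty →
      Q K = ((-1 : ℝ)) ^ (N - K.card) * Q Finset.univ := by
  intro K
  induction K using WellFoundedGT.induction with
  | ind K ih =>
    intro hK
    by_cases hKu : K = Finset.univ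
    · simp [hKu]
    have hmem : K ∈ Finset.univ.powerset.filter (fun L => K ⊆ L) := by simp
    have hsum := hQ K hK hKu
    have halt := sum_superset_neg_one_pow_card_compl hKu
    rw [Fintype.card_fin] at halt
    rw [← Finset.add_sum_erase _ _ hmem] at hsum halt
    have hrest : ∑ L ∈ (Finset.univ.powerset.filter (fun L => K ⊆ L)).erase K, Q L =
        (∑ L ∈ (Finset.univ.powerset.filter (fun L => K ⊆ L)).erase K,
          (-1 : ℝ) ^ (N - L.card)) * Q Finset.univ := by
      rw [Finset.sum_mul]
      refine Finset.sum_congr rfl fun L hL => ?_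
      simp only [Finset.mem_erase, Finset.mem_filter] at hL
      exact ih L (lt_of_le_of_ne hL.2.2 (Ne.symm hL.1)) (hK.mono hL.2.2)
    rw [hrest] at hsum
    linear_combination hsum - Q Finset.univ * halt
end
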